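/- Let f : Γ → Γ' be a morphism of dual graphs, i.e., a morphism of the underlying graphs (given by f_* : V → V' and f^* : F' → F, with f^* bijective on legs, injective on edges, and such that the two maps h, h∘τ : F ∖ f^*(F') → V followed by f_* : V → V' form a coequalizer diagram) satisfying 2g(v') − 2 + n(v') = Σ_{f_*(v) = v'} (2g(v) − 2 + n(v)) for every vertex v' of Γ'. Then the genera of Γ and Γ' coincide: g(Γ) = g(Γ'), where g(Γ) is the unique integer satisfying 2·g(Γ) − 2 + n(Γ) = Σ_{v ∈ V} (2·g(v) − 2 + n(v)). -/

import Mathlib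

open Finset

/-- If `f : Γ → Γ'` is a morphism of dual graphs — given by `f_* : V → V'` and
`f^* : F' → F` compatible with the involutions, with `f^*` bijective on legs and injective on
(flags of) edges, such that `F ∖ f^*(F') ⇉ V → V'` is a coequalizer, and satisfying
`2g(v') − 2 + n(v') = Σ_{f_*(v) = v'} (2g(v) − 2 + n(v))` for every vertex `v'` — then the
genera of `Γ` and `Γ'` coincide, where the genus of a dual graph is the unique integer with
`2·g(Γ) − 2 + n(Γ) = Σ_v (2·g(v) − 2 + n(v))`. -/
theorem dual_graph_morphism_preserves_genus.{u}
    {F V F' V' : Type u} [Fintype F] [Fintype V] [Fintype F'] [Fintype V']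
    [DecidableEq F] [DecidableEq V] [DecidableEq F'] [DecidableEq V']
    -- the two dual graphs
    (h : F → V) (τ : F → F) (hτ : ∀ x, τ (τ x) = x) (g : V → ℕ)
    (h' : F' → V') (τ' : F' → F') (hτ' : ∀ x, τ' (τ' x) = x) (g' : V' → ℕ)
    -- the underlying morphism of graphs
    (fV : V → V') (fF : F' → F)
    (hcompat : ∀ x' : F', fF (τ' x') = τ (fF x'))
    -- `f^*` is bijective on legs
    (hlegs : Set.BijOn fF {x' | τ' x' = x'} {x | τ x = x})
    -- `f^*` is injective on edges
    (hedges : Set.InjOn fF {x' | τ' x' ≠ x'})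
    -- the coequalizer condition for `F ∖ f^*(F') ⇉ V → V'`
    (hcoeq₁ : ∀ x : F, x ∉ Set.range fF → fV (h x) = fV (h (τ x)))
    (hcoeq₂ : ∀ (W : Type u) (q : V → W),
      (∀ x : F, x ∉ Set.range fF → q (h x) = q (h (τ x))) →
        ∃! q' : V' → W, q' ∘ fV = q)
    -- the condition making `f` a morphism of *dual* graphs
    (hgen : ∀ v' : V',
      2 * (g' v' : ℤ) - 2 + ((univ.filter fun x' => h' x' = v').card : ℤ)
        = ∑ v ∈ univ.filter fun v => fV v = v',
            (2 * (g v : ℤ) - 2 + ((univ.filter fun x => h x = v).card : ℤ)))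
    -- the genera of `Γ` and `Γ'`, characterized by their defining property
    (gΓ gΓ' : ℤ)
    (hgΓ : 2 * gΓ - 2 + ((univ.filter fun x => τ x = x).card : ℤ)
      = ∑ v, (2 * (g v : ℤ) - 2 + ((univ.filter fun x => h x = v).card : ℤ)))
    (hgΓ' : 2 * gΓ' - 2 + ((univ.filter fun x' => τ' x' = x').card : ℤ)
      = ∑ v', (2 * (g' v' : ℤ) - 2 + ((univ.filter fun x' => h' x' = v').card : ℤ))) :
    gΓ = gΓ' := by
  have hcard : (univ.filter fun x => τ x = x).card
      = (univ.filter fun x' => τ' x' = x').card :=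
    (card_bij (fun x' _ => fF x')
      (fun x' hx' => by simpa using hlegs.mapsTo (by simpa using hx'))
      (fun a ha b hb hab => hlegs.injOn (by simpa using ha) (by simpa using hb) hab)
      (fun x hx => by
        obtain ⟨x', hx', rfl⟩ := hlegs.surjOn (show x ∈ {x | τ x = x} by simpa using hx)
        exact ⟨x', by simpa using hx', rfl⟩)).symm
  have hsum := sum_fiberwise univ fV
    (fun v => (2 * (g v : ℤ) - 2 + ((univ.filter fun x => h x = v).card : ℤ)))
  rw [sum_congr rfl fun v' _ => hgen v', hsum, ← hgΓ, ← hcard] at hgΓ'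
  linarith
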